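/- Let M ∈ ℂ^{N×N} be Hermitian, invertible and centro-Hermitian (M = J M* J), and let Σ ∈ ℂ^{N×N} be Hermitian. Then tr(M^{−1} Σ) = tr(M^{−1} Σ_FB), where Σ_FB = (Σ + J Σ* J)/2. -/

import Mathlib

open Matrix
open scoped ComplexOrder

noncomputable section

/-- The `N × N` exchange matrix `J` (ones on the anti-diagonal, zeros elsewhere). -/
def Jex (N : ℕ) : Matrix (Fin N) (Fin N) ℂ :=
  Matrix.of fun i j => if (i : ℕ) + (j : ℕ) = N - 1 then 1 else 0

/-- `M` is centro-Hermitian: `M = J M* J`, where `M*` is the entrywise complex conjugate. -/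
def CentroHermitian {N : ℕ} (M : Matrix (Fin N) (Fin N) ℂ) : Prop :=
  M = Jex N * M.map (starRingEnd ℂ) * Jex N

/-- Forward–backward average `Σ_FB = (Σ + J Σ* J)/2`. -/
def fbAvg {N : ℕ} (S : Matrix (Fin N) (Fin N) ℂ) : Matrix (Fin N) (Fin N) ℂ :=
  (1 / 2 : ℂ) • (S + Jex N * S.map (starRingEnd ℂ) * Jex N)

theorem Jex_mul_self (N : ℕ) : Jex N * Jex N = 1 := by
  ext i j
  rw [Matrix.mul_apply, Finset.sum_eq_single (Fin.rev i)]
  · have h1 : (i : ℕ) + (Fin.rev i : ℕ) = N - 1 := by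
      rw [Fin.val_rev]; omega
    have h2 : ((Fin.rev i : ℕ) + (j : ℕ) = N - 1) ↔ i = j := by
      rw [Fin.val_rev, Fin.ext_iff]; omega
    simp only [Jex, Matrix.of_apply, h1, h2, Matrix.one_apply, if_true, one_mul]
  · intro b _ hb
    have h1 : ¬ ((i : ℕ) + (b : ℕ) = N - 1) := by
      intro h
      apply hb
      rw [Fin.ext_iff, Fin.val_rev]; omega
    simp [Jex, h1]
  · simp

theorem map_conj_of_herm {N : ℕ} {A : Matrix (Fin N) (Fin N) ℂ} (h : A.IsHermitian) :
    A.map (starRingEnd ℂ) = Aᵀ := by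
  ext i j
  exact h.apply j i

/-- if `M` is Hermitian, invertible and centro-Hermitian, and `Σ` is Hermitian,
then `tr(M⁻¹ Σ) = tr(M⁻¹ Σ_FB)`. -/
theorem stmt11 {N : ℕ} (M S : Matrix (Fin N) (Fin N) ℂ)
    (hM : M.IsHermitian) (hMinv : IsUnit M.det) (hMc : CentroHermitian M)
    (hS : S.IsHermitian) :
    (M⁻¹ * S).trace = (M⁻¹ * fbAvg S).trace := by
  have hJ := Jex_mul_self N
  have hJi : (Jex N)⁻¹ = Jex N := Matrix.inv_eq_right_inv hJ
  unfold CentroHermitian at hMc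
  rw [map_conj_of_herm hM] at hMc
  have hI : M⁻¹ = Jex N * (M⁻¹)ᵀ * Jex N := by
    conv_lhs => rw [hMc]
    rw [Matrix.mul_inv_rev, Matrix.mul_inv_rev, hJi, Matrix.transpose_nonsing_inv,
      Matrix.mul_assoc]
  have key : (M⁻¹ * (Jex N * Sᵀ * Jex N)).trace = (M⁻¹ * S).trace := by
    have h1 : M⁻¹ * (Jex N * Sᵀ * Jex N) = Jex N * ((M⁻¹)ᵀ * Sᵀ * Jex N) := by
      conv_lhs => rw [hI]
      calc _ = Jex N * (M⁻¹)ᵀ * (Jex N * Jex N) * Sᵀ * Jex N := by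
            simp only [Matrix.mul_assoc]
        _ = _ := by rw [hJ]; simp only [Matrix.mul_assoc, Matrix.mul_one]
    rw [h1, Matrix.trace_mul_comm, Matrix.mul_assoc, hJ, Matrix.mul_one,
      ← Matrix.transpose_mul, Matrix.trace_transpose, Matrix.trace_mul_comm]
  unfold fbAvg
  rw [map_conj_of_herm hS, Matrix.mul_smul, Matrix.trace_smul, Matrix.mul_add,
    Matrix.trace_add, key, smul_eq_mul]
  ring
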